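/- arXiv:1410.8377 — 4 statements merged into one kernel-verified Lean document; each statement's English description precedes it below -/
import Mathlib

section
/- Let n, n' ≥ 2 and 1 ≤ i ≤ n. Define f : [n+n'-1] → [n] by f(s) = s for s < i, f(s) = i for i ≤ s ≤ i+n'-1, and f(s) = s-n'+1 for s ≥ i+n'; and define g : [n'] → [n+n'-1] by g(ℓ) = i+ℓ-1. Then the images of π_f : 𝔱_n → 𝔱_{n+n'-1} and κ_g : 𝔱_{n'} → 𝔱_{n+n'-1} commute elementwise: [π_f(x), κ_g(y)] = 0 in 𝔱_{n+n'-1} for all x ∈ 𝔱_n and y ∈ 𝔱_{n'}. Consequently, the map (x, y) ↦ π_f(x) + κ_g(y) is a morphism of Lie algebras ∘_i : 𝔱_n × 𝔱_{n'} → 𝔱_{n+n'-1} from the product (direct sum) Lie algebra. -/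
noncomputable section

/-- Generators of the infinitesimal braid Lie algebra: unordered pairs `{i,j} ⊆ [n]`
with `i ≠ j`. -/
abbrev BraidGen (n : ℕ) := {s : Sym2 (Fin n) // ¬ s.IsDiag}

/-- The free Lie algebra over ℚ on the generators `t_{ij} = t_{ji}`, `i ≠ j`. -/
abbrev FreeT (n : ℕ) := FreeLieAlgebra ℚ (BraidGen n)

/-- The generator `t_{ij}` of the free Lie algebra, for `i ≠ j`. -/
def tfree {n : ℕ} (i j : Fin n) (h : i ≠ j) : FreeT n :=
  FreeLieAlgebra.of ℚ ⟨s(i, j), by simpa using h⟩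

/-- The infinitesimal braid relations: `[t_{ij}, t_{kl}]` for `{i,j} ∩ {k,l} = ∅` and
`[t_{ij} + t_{jk}, t_{ik}]` for `i, j, k` distinct. -/
def braidRels (n : ℕ) : Set (FreeT n) :=
  {x | ∃ (i j k l : Fin n) (hij : i ≠ j) (hkl : k ≠ l),
      i ≠ k ∧ i ≠ l ∧ j ≠ k ∧ j ≠ l ∧ x = ⁅tfree i j hij, tfree k l hkl⁆} ∪
  {x | ∃ (i j k : Fin n) (hij : i ≠ j) (hjk : j ≠ k) (hik : i ≠ k),
      x = ⁅tfree i j hij + tfree j k hjk, tfree i k hik⁆}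

/-- The Lie ideal of `FreeT n` generated by the infinitesimal braid relations. -/
def braidIdeal (n : ℕ) : LieIdeal ℚ (FreeT n) :=
  LieSubmodule.lieSpan ℚ (FreeT n) (braidRels n)

/-- The infinitesimal braid Lie algebra `𝔱_n` on `n` strands over ℚ. -/
abbrev T (n : ℕ) := FreeT n ⧸ braidIdeal n

/-- The generator `t_{ij}` of `𝔱_n` (with junk value `0` when `i = j`). -/
def tgen {n : ℕ} (i j : Fin n) : T n :=
  if h : i ≠ j then LieSubmodule.Quotient.mk (N := braidIdeal n) (tfree i j h) else 0

/-- `π` is the morphism `π_f : 𝔱_n → 𝔱_k` associated to `f : [k] → [n]`, i.e. it satisfies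
`π(t_{ij}) = ∑_{{a,b} : {f(a),f(b)}={i,j}} t_{ab}` on generators. -/
def IsPi {n k : ℕ} (f : Fin k → Fin n) (π : T n →ₗ⁅ℚ⁆ T k) : Prop :=
  ∀ (i j : Fin n), i ≠ j →
    π (tgen i j) =
      ∑ p ∈ Finset.univ.filter
          (fun p : Fin k × Fin k => p.1 < p.2 ∧ s(f p.1, f p.2) = s(i, j)),
        tgen p.1 p.2

/-- `κ` is the morphism `κ_g : 𝔱_n → 𝔱_m` associated to an injection `g : [n] → [m]`,
i.e. it satisfies `κ(t_{ij}) = t_{g(i)g(j)}` on generators. -/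
def IsKappa {n m : ℕ} (g : Fin n → Fin m) (κ : T n →ₗ⁅ℚ⁆ T m) : Prop :=
  ∀ (i j : Fin n), i ≠ j → κ (tgen i j) = tgen (g i) (g j)

theorem FreeLieAlgebra.induction_on {R X : Type*} [CommRing R] {p : FreeLieAlgebra R X → Prop}
    (of : ∀ x, p (FreeLieAlgebra.of R x)) (zero : p 0) (add : ∀ a b, p a → p b → p (a + b))
    (smul : ∀ (r : R) a, p a → p (r • a)) (lie : ∀ a b, p a → p b → p ⁅a, b⁆)
    (x : FreeLieAlgebra R X) : p x := by
  let S : LieSubalgebra R (FreeLieAlgebra R X) :=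
    { carrier := {a | p a}
      zero_mem' := zero
      add_mem' := fun {a b} ha hb => add a b ha hb
      smul_mem' := fun r a ha => smul r a ha
      lie_mem' := fun {a b} ha hb => lie a b ha hb }
  let φ : FreeLieAlgebra R X →ₗ⁅R⁆ S :=
    FreeLieAlgebra.lift R fun x => ⟨FreeLieAlgebra.of R x, of x⟩
  have hφ : S.incl.comp φ = LieHom.id := by
    apply FreeLieAlgebra.hom_ext
    intro x
    simp [φ]
  have hx : (φ x : FreeLieAlgebra R X) = x := LieHom.congr_fun hφ x
  have hmem : (φ x : FreeLieAlgebra R X) ∈ S := (φ x).2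
  rw [hx] at hmem
  exact hmem

theorem T.induction_on {n : ℕ} {p : T n → Prop} (tgen : ∀ i j, i ≠ j → p (tgen i j))
    (zero : p 0) (add : ∀ a b, p a → p b → p (a + b)) (smul : ∀ (r : ℚ) a, p a → p (r • a))
    (lie : ∀ a b, p a → p b → p ⁅a, b⁆) (x : T n) : p x := by
  obtain ⟨y, rfl⟩ := LieSubmodule.Quotient.surjective_mk' (braidIdeal n) x
  induction y using FreeLieAlgebra.induction_on with
  | of s =>
    obtain ⟨s, hs⟩ := s
    induction s using Sym2.ind with
    | _ i j =>
      have hij : i ≠ j := by simpa using hs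
      have h := tgen i j hij
      rwa [_root_.tgen, dif_pos hij] at h
  | zero => simpa using zero
  | add a b ha hb => simpa using add _ _ ha hb
  | smul r a ha => simpa using smul r _ ha
  | lie a b ha hb => exact lie _ _ ha hb

theorem tgen_comm {n : ℕ} (i j : Fin n) : tgen i j = tgen j i := by
  by_cases h : i = j
  · rw [h]
  · simp only [tgen, tfree, ne_eq, h, Ne.symm h, not_false_eq_true, dif_pos, Sym2.eq_swap]

theorem lie_tgen_of_disjoint {n : ℕ} {i j k l : Fin n} (hik : i ≠ k) (hil : i ≠ l)
    (hjk : j ≠ k) (hjl : j ≠ l) : ⁅tgen i j, tgen k l⁆ = 0 := by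
  by_cases hij : i = j
  · simp [tgen, hij]
  by_cases hkl : k = l
  · simp [tgen, hkl]
  rw [tgen, tgen, dif_pos hij, dif_pos hkl, ← LieSubmodule.Quotient.mk_bracket,
    LieSubmodule.Quotient.mk_eq_zero']
  exact LieSubmodule.subset_lieSpan (Or.inl ⟨i, j, k, l, hij, hkl, hik, hil, hjk, hjl, rfl⟩)

theorem lie_tgen_add_tgen {n : ℕ} {i j k : Fin n} (hij : i ≠ j) (hjk : j ≠ k) (hik : i ≠ k) :
    ⁅tgen i j + tgen k j, tgen i k⁆ = 0 := by
  rw [tgen_comm k j, tgen, tgen, tgen, dif_pos hij, dif_pos hjk, dif_pos hik]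
  change LieSubmodule.Quotient.mk (N := braidIdeal n)
    ⁅tfree i j hij + tfree j k hjk, tfree i k hik⁆ = 0
  rw [LieSubmodule.Quotient.mk_eq_zero']
  exact LieSubmodule.subset_lieSpan (Or.inr ⟨i, j, k, hij, hjk, hik, rfl⟩)

/-- Symmetrizing `t_{pq}` over the transposition `(u v)` gives an element commuting with
`t_{uv}`. -/
theorem lie_tgen_add_tgen_swap {n : ℕ} {p q u v : Fin n} (huv : u ≠ v)
    (h : ¬ ((p = u ∨ p = v) ∧ (q = u ∨ q = v))) :
    ⁅tgen p q, tgen u v⁆ + ⁅tgen (Equiv.swap u v p) (Equiv.swap u v q), tgen u v⁆ = 0 := by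
  have key : ∀ q, q ≠ u → q ≠ v → ⁅tgen u q, tgen u v⁆ + ⁅tgen v q, tgen u v⁆ = 0 := by
    intro q hu hv
    rw [← add_lie]
    exact lie_tgen_add_tgen hu.symm hv huv
  by_cases hp : p = u ∨ p = v
  · have hq : q ≠ u ∧ q ≠ v := by tauto
    rw [Equiv.swap_apply_of_ne_of_ne hq.1 hq.2]
    rcases hp with rfl | rfl
    · rw [Equiv.swap_apply_left]
      exact key q hq.1 hq.2
    · rw [Equiv.swap_apply_right, add_comm]
      exact key q hq.1 hq.2
  · have hp : p ≠ u ∧ p ≠ v := by tauto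
    rw [Equiv.swap_apply_of_ne_of_ne hp.1 hp.2]
    by_cases hq : q = u ∨ q = v
    · rw [tgen_comm p q, tgen_comm p]
      rcases hq with rfl | rfl
      · rw [Equiv.swap_apply_left]
        exact key p hp.1 hp.2
      · rw [Equiv.swap_apply_right, add_comm]
        exact key p hp.1 hp.2
    · have hq : q ≠ u ∧ q ≠ v := by tauto
      rw [Equiv.swap_apply_of_ne_of_ne hq.1 hq.2, lie_tgen_of_disjoint hp.1 hp.2 hq.1 hq.2,
        add_zero]

theorem sum_tgen_fiber_eq {n k : ℕ} (f : Fin k → Fin n) {i j : Fin n} (hij : i ≠ j) :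
    ∑ p ∈ Finset.univ.filter
        (fun p : Fin k × Fin k => p.1 < p.2 ∧ s(f p.1, f p.2) = s(i, j)), tgen p.1 p.2 =
      ∑ p ∈ Finset.univ.filter (fun p : Fin k × Fin k => f p.1 = i ∧ f p.2 = j),
        tgen p.1 p.2 := by
  refine Finset.sum_nbij' (fun p => if f p.1 = i then p else p.swap)
    (fun p => if p.1 < p.2 then p else p.swap) ?_ ?_ ?_ ?_ ?_
  · rintro ⟨a, b⟩ h
    simp only [Finset.mem_filter, Finset.mem_univ, true_and, Sym2.eq_iff] at h ⊢
    split_ifs <;> grind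
  · rintro ⟨a, b⟩ h
    simp only [Finset.mem_filter, Finset.mem_univ, true_and, Sym2.eq_iff] at h ⊢
    split_ifs <;> grind
  · rintro ⟨a, b⟩ h
    simp only [Finset.mem_filter, Finset.mem_univ, true_and, Sym2.eq_iff] at h ⊢
    grind
  · rintro ⟨a, b⟩ h
    simp only [Finset.mem_filter, Finset.mem_univ, true_and] at h ⊢
    grind
  · rintro ⟨a, b⟩ -
    dsimp only
    split_ifs
    · rfl
    · exact tgen_comm a b

theorem IsPi.lie_tgen_eq_zero {n k : ℕ} {f : Fin k → Fin n} {P : T n →ₗ⁅ℚ⁆ T k} (hP : IsPi f P)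
    {i j : Fin n} (hij : i ≠ j) {u v : Fin k} (huv : u ≠ v) (hf : f u = f v) :
    ⁅P (tgen i j), tgen u v⁆ = 0 := by
  rw [hP i j hij, sum_tgen_fiber_eq f hij, sum_lie]
  have hfs : ∀ a, f (Equiv.swap u v a) = f a := by
    intro a
    rw [Equiv.swap_apply_def]
    split_ifs <;> simp_all
  set S := Finset.univ.filter (fun p : Fin k × Fin k => f p.1 = i ∧ f p.2 = j)
  have hswap : ∑ p ∈ S, ⁅tgen p.1 p.2, tgen u v⁆ =
      ∑ p ∈ S, ⁅tgen (Equiv.swap u v p.1) (Equiv.swap u v p.2), tgen u v⁆ :=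
    Finset.sum_nbij' (Prod.map (Equiv.swap u v) (Equiv.swap u v))
      (Prod.map (Equiv.swap u v) (Equiv.swap u v))
      (by simp [S, hfs]) (by simp [S, hfs]) (by simp) (by simp) (by simp)
  suffices h : (2 : ℚ) • ∑ p ∈ S, ⁅(tgen p.1 p.2 : T k), tgen u v⁆ = 0 from
    (smul_eq_zero.mp h).resolve_left two_ne_zero
  rw [two_smul]
  nth_rewrite 2 [hswap]
  rw [← Finset.sum_add_distrib]
  refine Finset.sum_eq_zero fun p hp => lie_tgen_add_tgen_swap huv ?_
  simp only [S, Finset.mem_filter, Finset.mem_univ, true_and] at hp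
  grind

/-- If `g` maps into a single fibre of `f`, the images of `π_f` and `κ_g` commute. -/
theorem IsPi.lie_isKappa_eq_zero {n m k : ℕ} {f : Fin k → Fin n} {g : Fin m → Fin k}
    {P : T n →ₗ⁅ℚ⁆ T k} {K : T m →ₗ⁅ℚ⁆ T k} (hP : IsPi f P) (hK : IsKappa g K)
    (hg : Function.Injective g) (hfg : ∀ a b, f (g a) = f (g b)) (x : T n) (y : T m) :
    ⁅P x, K y⁆ = 0 := by
  induction x using T.induction_on with
  | tgen i j hij =>
    induction y using T.induction_on with
    | tgen a b hab =>
      rw [hK a b hab]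
      exact hP.lie_tgen_eq_zero hij (hg.ne hab) (hfg a b)
    | zero => simp
    | add a b ha hb => rw [map_add, lie_add, ha, hb, add_zero]
    | smul r a ha => rw [map_smul, lie_smul, ha, smul_zero]
    | lie a b ha hb => rw [LieHom.map_lie, leibniz_lie, ha, hb, zero_lie, lie_zero, add_zero]
  | zero => simp
  | add a b ha hb => rw [map_add, add_lie, ha, hb, add_zero]
  | smul r a ha => rw [map_smul, smul_lie, ha, smul_zero]
  | lie a b ha hb => rw [LieHom.map_lie, lie_lie, ha, hb, lie_zero, lie_zero, sub_zero]

/-- everything written 0-indexed: with `f : [n+n'-1] → [n]` and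
`g : [n'] → [n+n'-1]` as in the operadic composition `∘_i`, the images of
`π_f : 𝔱_n → 𝔱_{n+n'-1}` and `κ_g : 𝔱_{n'} → 𝔱_{n+n'-1}` commute elementwise, and
consequently `(x, y) ↦ π_f(x) + κ_g(y)` is a morphism of Lie algebras
`𝔱_n ⊕ 𝔱_{n'} → 𝔱_{n+n'-1}` (the bracket on the direct sum being componentwise). -/
theorem stmt5 (n n' : ℕ) (hn : 2 ≤ n) (hn' : 2 ≤ n') (i : ℕ) (hi : i < n)
    (f : Fin (n + n' - 1) → Fin n) (g : Fin n' → Fin (n + n' - 1))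
    (hf : ∀ s : Fin (n + n' - 1), (f s : ℕ) =
      if (s : ℕ) < i then (s : ℕ)
      else if (s : ℕ) ≤ i + n' - 1 then i
      else (s : ℕ) - n' + 1)
    (hg : ∀ l : Fin n', (g l : ℕ) = i + (l : ℕ))
    (P : T n →ₗ⁅ℚ⁆ T (n + n' - 1)) (K : T n' →ₗ⁅ℚ⁆ T (n + n' - 1))
    (hP : IsPi f P) (hK : IsKappa g K) :
    (∀ (x : T n) (y : T n'), ⁅P x, K y⁆ = 0) ∧
    ∃ h : (T n × T n') →ₗ[ℚ] T (n + n' - 1),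
      (∀ (x : T n) (y : T n'), h (x, y) = P x + K y) ∧
      ∀ a b : T n × T n', h (⁅a.1, b.1⁆, ⁅a.2, b.2⁆) = ⁅h a, h b⁆ := by
  have comm : ∀ (x : T n) (y : T n'), ⁅P x, K y⁆ = 0 := by
    refine hP.lie_isKappa_eq_zero hK (fun a b hab => ?_) fun a b => ?_
    · have h := congrArg Fin.val hab
      rw [hg, hg] at h
      exact Fin.ext (by omega)
    · have key : ∀ l, (f (g l) : ℕ) = i := by
        intro l
        have hl := l.isLt
        rw [hf, hg, if_neg (by omega), if_pos (by omega)]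
      exact Fin.ext (by rw [key, key])
  refine ⟨comm, LinearMap.coprod (P : T n →ₗ[ℚ] _) (K : T n' →ₗ[ℚ] _), fun x y => rfl, ?_⟩
  rintro ⟨x, y⟩ ⟨x', y'⟩
  change P ⁅x, x'⁆ + K ⁅y, y'⁆ = ⁅P x + K y, P x' + K y'⁆
  have h : ⁅K y, P x'⁆ = 0 := by rw [← lie_skew, comm, neg_zero]
  rw [LieHom.map_lie, LieHom.map_lie, add_lie, lie_add, lie_add, comm, h, add_zero, zero_add]
end
end

section
/- For n ≥ 3, the kernel of the induced odd derivation ι_v on the Arnol'd algebra coGer(n) equals the unital subalgebra of coGer(n) generated by the elements α_{ij} := ω_{i\,j+1} + ω_{i+1\,j} - ω_{i+1\,j+1} - ω_{ij}, where {i,j} ranges over the chords in χ_{n+1}, indices are taken modulo n+1 in {1,…,n+1}, and one uses the convention ω_{a\,n+1} := 0 for all a. -/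
noncomputable section

/-- Generators of the Arnol'd algebra: unordered pairs `{i,j} ⊆ [n]` with `i ≠ j`. -/
abbrev ArnGen (n : ℕ) := {s : Sym2 (Fin n) // ¬ s.IsDiag}

/-- The ℚ-vector space with basis the generators `ω_{ij} = ω_{ji}`. -/
abbrev ArnV (n : ℕ) := ArnGen n →₀ ℚ

/-- The exterior algebra over ℚ on the degree-1 generators `ω_{ij}`. -/
abbrev ExtA (n : ℕ) := ExteriorAlgebra ℚ (ArnV n)

/-- The generator `ω_{ij}` of the exterior algebra, for `i ≠ j`. -/
def wfree {n : ℕ} (i j : Fin n) (h : i ≠ j) : ExtA n :=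
  ExteriorAlgebra.ι ℚ (Finsupp.single ⟨s(i, j), by simpa using h⟩ 1)

/-- The Arnol'd elements `ω_{ij}ω_{jk} + ω_{jk}ω_{ki} + ω_{ki}ω_{ij}` for distinct
`i, j, k` (using `ω_{ki} = ω_{ik}`). -/
def arnoldRels (n : ℕ) : Set (ExtA n) :=
  {x | ∃ (i j k : Fin n) (hij : i ≠ j) (hjk : j ≠ k) (hik : i ≠ k),
    x = wfree i j hij * wfree j k hjk + wfree j k hjk * wfree i k hik +
        wfree i k hik * wfree i j hij}

/-- The Arnol'd algebra `coGer(n)`: the quotient of the exterior algebra by the two-sided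
ideal generated by the Arnol'd elements. -/
abbrev CoGer (n : ℕ) := RingQuot (fun a b : ExtA n => a ∈ arnoldRels n ∧ b = 0)

/-- The quotient map onto the Arnol'd algebra. -/
def mkCoGer (n : ℕ) : ExtA n →ₐ[ℚ] CoGer n :=
  RingQuot.mkAlgHom ℚ (fun a b : ExtA n => a ∈ arnoldRels n ∧ b = 0)

/-- The class `ω_{ij}` in the Arnol'd algebra (junk value `0` when `i = j`). -/
def w {n : ℕ} (i j : Fin n) : CoGer n :=
  if h : i ≠ j then mkCoGer n (wfree i j h) else 0

/-- The degree-`k` homogeneous component of the Arnol'd algebra: the image of the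
degree-`k` component of the exterior algebra. -/
def degComp (n k : ℕ) : Submodule ℚ (CoGer n) :=
  Submodule.map (mkCoGer n).toLinearMap
    ((LinearMap.range (ExteriorAlgebra.ι ℚ : ArnV n →ₗ[ℚ] ExtA n)) ^ k)

/-- The class `ω_{ab}` for indices `a, b` ranging over `[n+1]` (0-indexed: over
`Fin (n+1)`), with the convention that `ω_{ab} = 0` whenever an index equals `n+1`
(0-indexed: equals `n`). -/
def wbar (n : ℕ) (a b : Fin (n + 1)) : CoGer n :=
  if h : (a : ℕ) < n ∧ (b : ℕ) < n then w (⟨a, h.1⟩ : Fin n) (⟨b, h.2⟩ : Fin n) else 0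

/-- The element `α_{ij} = ω_{i,j+1} + ω_{i+1,j} - ω_{i+1,j+1} - ω_{ij}` of the Arnol'd
algebra, indices taken modulo `n+1` (addition in `Fin (n+1)`). -/
def alphaChord (n : ℕ) (i j : Fin (n + 1)) : CoGer n :=
  wbar n i (j + 1) + wbar n (i + 1) j - wbar n (i + 1) (j + 1) - wbar n i j

theorem w_comm {n : ℕ} (i j : Fin n) : w i j = w j i := by
  unfold w
  by_cases h : i = j
  · simp [h]
  · have h' : j ≠ i := fun e => h e.symm
    simp only [ne_eq, h, h', not_false_eq_true, dite_true, wfree, Sym2.eq_swap]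

theorem one_mem_degComp (n : ℕ) : (1 : CoGer n) ∈ degComp n 0 :=
  ⟨1, by simp, map_one (mkCoGer n)⟩

theorem mkCoGer_ι_mem_degComp {n : ℕ} (v : ArnV n) :
    mkCoGer n (ExteriorAlgebra.ι ℚ v) ∈ degComp n 1 :=
  ⟨_, by simp, rfl⟩

theorem mem_degComp_one {n : ℕ} {x : CoGer n} (hx : x ∈ degComp n 1) :
    ∃ v : ArnV n, mkCoGer n (ExteriorAlgebra.ι ℚ v) = x := by
  obtain ⟨y, hy, rfl⟩ := hx
  rw [pow_one] at hy
  obtain ⟨v, rfl⟩ := hy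
  exact ⟨v, rfl⟩

theorem w_mem_degComp {n : ℕ} (i j : Fin n) : w i j ∈ degComp n 1 := by
  unfold w
  split_ifs with h
  · exact mkCoGer_ι_mem_degComp _
  · exact zero_mem _

theorem wbar_mem_degComp (n : ℕ) (a b : Fin (n + 1)) : wbar n a b ∈ degComp n 1 := by
  unfold wbar
  split_ifs
  · exact w_mem_degComp _ _
  · exact zero_mem _

theorem alphaChord_mem_degComp (n : ℕ) (i j : Fin (n + 1)) :
    alphaChord n i j ∈ degComp n 1 :=
  sub_mem (sub_mem (add_mem (wbar_mem_degComp _ _ _) (wbar_mem_degComp _ _ _))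
    (wbar_mem_degComp _ _ _)) (wbar_mem_degComp _ _ _)

theorem mul_self_of_mem_degComp_one {n : ℕ} {x : CoGer n} (hx : x ∈ degComp n 1) :
    x * x = 0 := by
  obtain ⟨v, rfl⟩ := mem_degComp_one hx
  rw [← map_mul, ExteriorAlgebra.ι_sq_zero, map_zero]

theorem anticomm_of_mem_degComp_one {n : ℕ} {x y : CoGer n} (hx : x ∈ degComp n 1)
    (hy : y ∈ degComp n 1) : x * y = -(y * x) := by
  have h := mul_self_of_mem_degComp_one (add_mem hx hy)
  rw [add_mul, mul_add, mul_add, mul_self_of_mem_degComp_one hx,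
    mul_self_of_mem_degComp_one hy, zero_add, add_zero] at h
  exact eq_neg_of_add_eq_zero_left h

/-- The subalgebra generated by the elements `α_{ij}` over all chords. -/
def chordAlgebra (n : ℕ) : Subalgebra ℚ (CoGer n) :=
  Algebra.adjoin ℚ {x : CoGer n | ∃ i j : Fin (n + 1),
    j ≠ i ∧ j ≠ i + 1 ∧ i ≠ j + 1 ∧ x = alphaChord n i j}

theorem alphaChord_mem_chordAlgebra {n : ℕ} {i j : Fin (n + 1)} (h₁ : j ≠ i)
    (h₂ : j ≠ i + 1) (h₃ : i ≠ j + 1) : alphaChord n i j ∈ chordAlgebra n :=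
  Algebra.subset_adjoin ⟨i, j, h₁, h₂, h₃, rfl⟩

/-- The class `ω_{ab}` for natural-number indices, `0` when an index is at least `n`. -/
def wNat (n a b : ℕ) : CoGer n :=
  if h : a < n ∧ b < n then w (⟨a, h.1⟩ : Fin n) (⟨b, h.2⟩ : Fin n) else 0

theorem wbar_eq_wNat (n : ℕ) (a b : Fin (n + 1)) : wbar n a b = wNat n a b := rfl

theorem wNat_comm (n a b : ℕ) : wNat n a b = wNat n b a := by
  unfold wNat
  by_cases h : a < n ∧ b < n
  · rw [dif_pos h, dif_pos h.symm, w_comm]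
  · rw [dif_neg h, dif_neg fun h' => h h'.symm]

theorem wNat_right_self (n a : ℕ) : wNat n a n = 0 := by simp [wNat]

theorem val_add_one_of_lt_last {n : ℕ} (i : Fin (n + 1)) (h : (i : ℕ) < n) :
    ((i + 1 : Fin (n + 1)) : ℕ) = i + 1 :=
  Fin.val_add_one_of_lt (Fin.lt_def.2 (by simpa using h))

theorem val_add_one_of_eq_last {n : ℕ} (i : Fin (n + 1)) (h : (i : ℕ) = n) :
    ((i + 1 : Fin (n + 1)) : ℕ) = 0 := by
  have : i = Fin.last n := Fin.ext (by simpa using h)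
  simp [this]

theorem wNat_mixed_difference_mem {n a b : ℕ} (hab : a + 2 ≤ b) (hb : b < n) :
    wNat n a (b + 1) + wNat n (a + 1) b - wNat n (a + 1) (b + 1) - wNat n a b ∈
      chordAlgebra n := by
  have ha' := val_add_one_of_lt_last (⟨a, by omega⟩ : Fin (n + 1)) (by simp; omega)
  have hb' := val_add_one_of_lt_last (⟨b, by omega⟩ : Fin (n + 1)) (by simp; omega)
  have := alphaChord_mem_chordAlgebra (n := n) (i := ⟨a, by omega⟩) (j := ⟨b, by omega⟩)
    (by rw [ne_eq, Fin.ext_iff]; simp; omega) (by rw [ne_eq, Fin.ext_iff, ha']; simp; omega)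
    (by rw [ne_eq, Fin.ext_iff, hb']; simp; omega)
  simpa only [alphaChord, wbar_eq_wNat, ha', hb'] using this

theorem wNat_zero_step_mem {n a : ℕ} (ha : 1 ≤ a) (han : a + 1 < n) :
    wNat n 0 (a + 1) - wNat n 0 a ∈ chordAlgebra n := by
  have ha' := val_add_one_of_lt_last (⟨a, by omega⟩ : Fin (n + 1)) (by simp; omega)
  have hb' := val_add_one_of_eq_last (⟨n, by omega⟩ : Fin (n + 1)) rfl
  have := alphaChord_mem_chordAlgebra (n := n) (i := ⟨a, by omega⟩) (j := ⟨n, by omega⟩)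
    (by rw [ne_eq, Fin.ext_iff]; simp; omega) (by rw [ne_eq, Fin.ext_iff, ha']; simp; omega)
    (by rw [ne_eq, Fin.ext_iff, hb']; simp; omega)
  simp only [alphaChord, wbar_eq_wNat, ha', hb', wNat_right_self] at this
  rw [wNat_comm n 0, wNat_comm n 0]
  convert neg_mem this using 1
  abel

theorem wNat_zero_sub_mem {n b : ℕ} (hb : 1 ≤ b) (hbn : b < n) :
    wNat n 0 b - wNat n 0 1 ∈ chordAlgebra n := by
  induction b, hb using Nat.le_induction with
  | base => simp
  | succ b hb ih =>
    simpa using add_mem (wNat_zero_step_mem hb hbn) (ih (by omega))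

theorem wNat_last_sub_mem {n a : ℕ} (ha : a + 1 < n) :
    wNat n a (n - 1) - wNat n 0 1 ∈ chordAlgebra n := by
  induction a with
  | zero => exact wNat_zero_sub_mem (by omega) (by omega)
  | succ a ih =>
    have h := wNat_mixed_difference_mem (n := n) (a := a) (b := n - 1) (by omega) (by omega)
    rw [show n - 1 + 1 = n by omega, wNat_right_self, wNat_right_self] at h
    convert add_mem h (ih (by omega)) using 1
    abel

theorem wNat_sub_mem {n a b : ℕ} (hab : a < b) (hb : b < n) :
    wNat n a b - wNat n 0 1 ∈ chordAlgebra n := by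
  induction a generalizing b with
  | zero => exact wNat_zero_sub_mem (by omega) hb
  | succ a ih =>
    have hle : b ≤ n - 1 := by omega
    induction hle using Nat.decreasingInduction with
    | self => exact wNat_last_sub_mem (by omega)
    | of_succ b _ ihb =>
      have h := add_mem (add_mem (wNat_mixed_difference_mem (n := n) (a := a) (b := b)
        (by omega) (by omega)) (ihb (by omega) (by omega)))
        (sub_mem (ih (b := b) (by omega) (by omega)) (ih (b := b + 1) (by omega) (by omega)))
      convert h using 1
      abel

theorem w_sub_w_mem_chordAlgebra {n : ℕ} (hn : 3 ≤ n) {i j : Fin n} (hij : i ≠ j) :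
    w i j - w (⟨0, by omega⟩ : Fin n) ⟨1, by omega⟩ ∈ chordAlgebra n := by
  have hw : ∀ i j : Fin n, w i j = wNat n i j := fun i j => by simp [wNat]
  rw [hw, hw]
  rcases lt_or_gt_of_ne hij with h | h
  · exact wNat_sub_mem h j.2
  · rw [wNat_comm]
    exact wNat_sub_mem h i.2

/-- If every `ω_{ij}` is congruent to a fixed degree-one `ω` modulo `B`, then the Arnol'd algebra
is `B + ω B`. -/
theorem exists_add_mul_of_w_sub_mem {n : ℕ} {B : Subalgebra ℚ (CoGer n)} {ω : CoGer n}
    (hω : ω ∈ degComp n 1) (hB : ∀ i j : Fin n, i ≠ j → w i j - ω ∈ B) (x : CoGer n) :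
    ∃ b ∈ B, ∃ c ∈ B, x = b + ω * c := by
  let M : Submodule ℚ (CoGer n) :=
    Subalgebra.toSubmodule B ⊔ (Subalgebra.toSubmodule B).map (LinearMap.mulLeft ℚ ω)
  have hM : ∀ {z : CoGer n}, z ∈ M ↔ ∃ b ∈ B, ∃ c ∈ B, z = b + ω * c := by
    intro z
    simp only [M, Submodule.mem_sup, Submodule.mem_map, Subalgebra.mem_toSubmodule,
      LinearMap.mulLeft_apply, exists_exists_and_eq_and, eq_comm (a := z)]
  have hw : ∀ i j : Fin n, i ≠ j → ∀ m ∈ M, w i j * m ∈ M := by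
    intro i j hij m hm
    obtain ⟨b, hb, c, hc, rfl⟩ := hM.1 hm
    have hd := hB i j hij
    have hanti := anticomm_of_mem_degComp_one (sub_mem (w_mem_degComp i j) hω) hω
    have hsq := mul_self_of_mem_degComp_one hω
    set d := w i j - ω with hd_def
    have hwd : w i j = ω + d := by rw [hd_def]; abel
    refine hM.2 ⟨d * b, B.mul_mem hd hb, b - d * c, B.sub_mem hb (B.mul_mem hd hc), ?_⟩
    rw [hwd, add_mul, mul_add, mul_add, ← mul_assoc, ← mul_assoc, hsq, hanti]
    noncomm_ring
  have hι : ∀ v : ArnV n, ∀ m ∈ M, mkCoGer n (ExteriorAlgebra.ι ℚ v) * m ∈ M := by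
    intro v m hm
    induction v using Finsupp.induction_linear with
    | zero => simp
    | add f g hf hg => simpa [add_mul] using add_mem hf hg
    | single s q =>
      obtain ⟨s, hs⟩ := s
      induction s using Sym2.ind with
      | _ i j =>
        have hij : i ≠ j := by simpa using hs
        have := M.smul_mem q (hw i j hij m hm)
        rw [w, dif_pos hij, wfree, ← smul_mul_assoc, ← map_smul, ← map_smul] at this
        simpa using this
  have hall : ∀ y : ExtA n, ∀ m ∈ M, mkCoGer n y * m ∈ M := by
    intro y
    induction y using ExteriorAlgebra.induction with
    | algebraMap r =>
      intro m hm
      rw [AlgHom.commutes, ← Algebra.smul_def]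
      exact M.smul_mem r hm
    | ι v => exact hι v
    | mul a b ha hb =>
      intro m hm
      rw [map_mul, mul_assoc]
      exact ha _ (hb _ hm)
    | add a b ha hb =>
      intro m hm
      rw [map_add, add_mul]
      exact add_mem (ha _ hm) (hb _ hm)
  obtain ⟨y, rfl⟩ := RingQuot.mkAlgHom_surjective ℚ _ x
  have h1 : (1 : CoGer n) ∈ M := hM.2 ⟨1, B.one_mem, 0, B.zero_mem, by simp⟩
  simpa [mkCoGer] using hM.1 (hall y 1 h1)

theorem map_eq_zero_of_mem_adjoin {n : ℕ} {D : CoGer n →ₗ[ℚ] CoGer n}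
    (hder : ∀ m : ℕ, ∀ x ∈ degComp n m, ∀ y : CoGer n,
      D (x * y) = D x * y + ((-1 : ℚ) ^ m) • (x * D y))
    {S : Set (CoGer n)} (hS : ∀ x ∈ S, x ∈ degComp n 1 ∧ D x = 0) {b : CoGer n}
    (hb : b ∈ Algebra.adjoin ℚ S) : D b = 0 := by
  rw [← Subalgebra.mem_toSubmodule, Algebra.adjoin_eq_span] at hb
  suffices h : Submodule.span ℚ (Submonoid.closure S : Set (CoGer n)) ≤ LinearMap.ker D from h hb
  rw [Submodule.span_le]
  intro x hx
  change D x = 0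
  induction hx using Submonoid.closure_induction_left with
  | one => simpa using hder 0 1 (one_mem_degComp n) 1
  | mul_left x hx y _ hy =>
    rw [hder 1 x (hS x hx).1 y, (hS x hx).2, hy]
    simp

theorem map_wbar {n : ℕ} {D : CoGer n →ₗ[ℚ] CoGer n}
    (hgen : ∀ i j : Fin n, i ≠ j → D (w i j) = 1) {a b : Fin (n + 1)} (hab : a ≠ b) :
    D (wbar n a b) = if (a : ℕ) < n ∧ (b : ℕ) < n then 1 else 0 := by
  unfold wbar
  split_ifs with h
  · exact hgen _ _ fun e => hab (Fin.ext (by simpa using e))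
  · simp

theorem map_alphaChord {n : ℕ} {D : CoGer n →ₗ[ℚ] CoGer n}
    (hgen : ∀ i j : Fin n, i ≠ j → D (w i j) = 1) {i j : Fin (n + 1)} (h₁ : j ≠ i)
    (h₂ : j ≠ i + 1) (h₃ : i ≠ j + 1) : D (alphaChord n i j) = 0 := by
  have h₄ : i + 1 ≠ j + 1 := fun e => h₁ (add_right_cancel e).symm
  rw [alphaChord, map_sub, map_sub, map_add, map_wbar hgen h₃, map_wbar hgen h₂.symm,
    map_wbar hgen h₄, map_wbar hgen h₁.symm]
  have hi : (i : ℕ) < n ∨ ((i : ℕ) = n ∧ ((i + 1 : Fin (n + 1)) : ℕ) ≠ n) ∨ n = 0 := by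
    by_cases h : (i : ℕ) < n
    · exact Or.inl h
    · have := val_add_one_of_eq_last i (by omega)
      omega
  rw [ne_eq, Fin.ext_iff] at h₁ h₂ h₃ h₄
  have := i.2
  have := j.2
  have := (i + 1).2
  have := (j + 1).2
  have hj : (j : ℕ) < n ∨ ((j : ℕ) = n ∧ ((j + 1 : Fin (n + 1)) : ℕ) ≠ n) ∨ n = 0 := by
    by_cases h : (j : ℕ) < n
    · exact Or.inl h
    · have := val_add_one_of_eq_last j (by omega)
      omega
  generalize ((i + 1 : Fin (n + 1)) : ℕ) = i' at *
  generalize ((j + 1 : Fin (n + 1)) : ℕ) = j' at *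
  split_ifs <;> first | omega | simp

/-- for `n ≥ 3`, the kernel of the induced odd derivation `ι_v` on the
Arnol'd algebra `coGer(n)` (the odd derivation with `ι_v(ω_{ij}) = 1` on all generators)
equals the unital subalgebra generated by the elements `α_{ij}`, `{i,j}` ranging over
the chords of `[n+1]`. -/
theorem stmt11 (n : ℕ) (hn : 3 ≤ n) (D : CoGer n →ₗ[ℚ] CoGer n)
    (hder : ∀ m : ℕ, ∀ x ∈ degComp n m, ∀ y : CoGer n,
      D (x * y) = D x * y + ((-1 : ℚ) ^ m) • (x * D y))
    (hgen : ∀ (i j : Fin n), i ≠ j → D (w i j) = 1) :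
    LinearMap.ker D =
      Subalgebra.toSubmodule (Algebra.adjoin ℚ
        {x : CoGer n | ∃ i j : Fin (n + 1),
          j ≠ i ∧ j ≠ i + 1 ∧ i ≠ j + 1 ∧ x = alphaChord n i j}) := by
  change LinearMap.ker D = Subalgebra.toSubmodule (chordAlgebra n)
  have hB : ∀ b ∈ chordAlgebra n, D b = 0 := fun b hb =>
    map_eq_zero_of_mem_adjoin hder
      (by
        rintro _ ⟨i, j, h₁, h₂, h₃, rfl⟩
        exact ⟨alphaChord_mem_degComp n i j, map_alphaChord hgen h₁ h₂ h₃⟩) hb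
  ext x
  rw [LinearMap.mem_ker, Subalgebra.mem_toSubmodule]
  refine ⟨fun hx => ?_, hB x⟩
  have hω := w_mem_degComp (⟨0, by omega⟩ : Fin n) ⟨1, by omega⟩
  obtain ⟨b, hb, c, hc, rfl⟩ :=
    exists_add_mul_of_w_sub_mem hω (fun i j => w_sub_w_mem_chordAlgebra hn) x
  rw [map_add, hB b hb, hder 1 _ hω c, hgen _ _ (by simp), hB c hc] at hx
  have hc0 : c = 0 := by simpa using hx
  simpa [hc0] using hb
end
end

section
/- Let k_1,…,k_r be integers with k_i ≥ 1 and k_r ≥ 2, set ℓ = k_1 + ⋯ + k_r, and define ε_1,…,ε_ℓ ∈ {0,1} by ε_j = 1 if j ∈ {1, k_1+1, k_1+k_2+1, …, k_1+⋯+k_{r-1}+1} and ε_j = 0 otherwise (i.e., the word ε_1⋯ε_ℓ is 1 0^{k_1-1} 1 0^{k_2-1} ⋯ 1 0^{k_r-1}). Define f_0(t) = 1/t and f_1(t) = 1/(1-t). Then the (nonnegative) function ∏_{j=1}^{ℓ} f_{ε_j}(t_j) is integrable on the open simplex {(t_1,…,t_ℓ) ∈ ℝ^ℓ : 0 < t_1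 < ⋯ < t_ℓ < 1}, and its integral equals the multiple zeta value ζ(k_1,…,k_r). -/
open MeasureTheory

/-- The multiple zeta value `ζ(k₀, …, k_r)` for `k : Fin (r+1) → ℕ`, defined as the sum
`∑_{0 < n₀ < ⋯ < n_r} 1/(n₀^{k₀} ⋯ n_r^{k_r})` over strictly increasing tuples of
positive integers. -/
noncomputable def mzv (r : ℕ) (k : Fin (r + 1) → ℕ) : ℝ :=
  ∑' nv : {g : Fin (r + 1) → ℕ // StrictMono g ∧ ∀ i, 0 < g i},
    ∏ i, (1 : ℝ) / ((nv.1 i : ℝ) ^ (k i))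

/-- The word `ε₁ ⋯ ε_ℓ = 1 0^{k₀-1} 1 0^{k₁-1} ⋯ 1 0^{k_r-1}` (0-indexed): position
`j` carries the letter 1 exactly when `j` is one of the partial sums `∑_{i' < i} k i'`. -/
def posIsOne (r : ℕ) (k : Fin (r + 1) → ℕ) (j : ℕ) : Prop :=
  j ∈ Finset.image
    (fun i : Fin (r + 1) => ∑ i' ∈ Finset.univ.filter (· < i), k i') Finset.univ

instance (r : ℕ) (k : Fin (r + 1) → ℕ) (j : ℕ) : Decidable (posIsOne r k j) := by
  unfold posIsOne; infer_instance

/-- The integrand `∏_j f_{ε_j}(t_j)` where `f₀(t) = 1/t` and `f₁(t) = 1/(1-t)`. -/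
noncomputable def kontsevichIntegrand (r : ℕ) (k : Fin (r + 1) → ℕ)
    (t : Fin (∑ i, k i) → ℝ) : ℝ :=
  ∏ j : Fin (∑ i, k i), if posIsOne r k j.1 then 1 / (1 - t j) else 1 / t j

/-- The open simplex `0 < t₁ < ⋯ < t_ℓ < 1`. -/
def openSimplex (ℓ : ℕ) : Set (Fin ℓ → ℝ) :=
  {t | StrictMono t ∧ ∀ j, t j ∈ Set.Ioo (0 : ℝ) 1}

open scoped ENNReal

/-- The differential form letter: `1/(1-y)` for the letter `1` (when `q` holds), `1/y` otherwise. -/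
noncomputable def letterForm (q : Prop) [Decidable q] (y : ℝ) : ℝ :=
  if q then 1 / (1 - y) else 1 / y

/-- The iterated integral of the word `p 0, …, p (m - 1)` over `0 < t₀ < ⋯ < t_{m-1} < x`, as an
extended nonnegative real. -/
noncomputable def iterInt (p : ℕ → Prop) [DecidablePred p] (m : ℕ) (x : ℝ) : ℝ≥0∞ :=
  ∫⁻ t : Fin m → ℝ,
    {t : Fin m → ℝ | StrictMono (Fin.cons 0 t : Fin (m + 1) → ℝ) ∧
      (Fin.cons 0 t : Fin (m + 1) → ℝ) (Fin.last m) < x}.indicator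
      (fun t => ∏ j : Fin m, ENNReal.ofReal (letterForm (p j) (t j))) t

/-- The power series coefficients of `iterInt p m`. -/
noncomputable def iterCoeff (p : ℕ → Prop) [DecidablePred p] : ℕ → ℕ → ℝ≥0∞
  | 0, n => if n = 0 then 1 else 0
  | m + 1, n => (if p m then ∑ j ∈ Finset.range n, iterCoeff p m j else iterCoeff p m n) / n

theorem strictMono_snoc_iff {α : Type*} [Preorder α] {m : ℕ} (f : Fin (m + 1) → α) (y : α) :
    StrictMono (Fin.snoc f y : Fin (m + 2) → α) ↔ StrictMono f ∧ f (Fin.last m) < y := by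
  rw [Fin.strictMono_iff_lt_succ, Fin.forall_fin_succ', Fin.strictMono_iff_lt_succ]
  simp only [Fin.snoc_castSucc, Fin.succ_last, Fin.snoc_last, Fin.succ_castSucc]

theorem strictMono_cons_snoc_iff {α : Type*} [Preorder α] {m : ℕ} (a : α) (t : Fin m → α) (y : α) :
    StrictMono (Fin.cons a (Fin.snoc t y : Fin (m + 1) → α) : Fin (m + 2) → α) ↔
      StrictMono (Fin.cons a t : Fin (m + 1) → α) ∧
        (Fin.cons a t : Fin (m + 1) → α) (Fin.last m) < y := by
  rw [Fin.cons_snoc_eq_snoc_cons, strictMono_snoc_iff]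

theorem measurable_letterForm (q : Prop) [Decidable q] : Measurable (letterForm q) := by
  unfold letterForm
  split_ifs <;> fun_prop

theorem measurableSet_strictMono_cons_lt (m : ℕ) (x : ℝ) :
    MeasurableSet {t : Fin m → ℝ | StrictMono (Fin.cons 0 t : Fin (m + 1) → ℝ) ∧
      (Fin.cons 0 t : Fin (m + 1) → ℝ) (Fin.last m) < x} := by
  have h : ∀ i : Fin (m + 1),
      Measurable fun t : Fin m → ℝ => (Fin.cons 0 t : Fin (m + 1) → ℝ) i := by
    intro i
    cases i using Fin.cases <;> simp only [Fin.cons_zero, Fin.cons_succ] <;> fun_prop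
  simp only [Fin.strictMono_iff_lt_succ]
  exact (measurableSet_setOfPred.2 <| Measurable.forall fun i => measurableSet_setOfPred.1 <|
    measurableSet_lt (h _) (h _)).inter (measurableSet_lt (h _) measurable_const)

theorem lintegral_fin_succ {m : ℕ} (g : (Fin (m + 1) → ℝ) → ℝ≥0∞) (hg : Measurable g) :
    ∫⁻ t, g t = ∫⁻ y : ℝ, ∫⁻ t : Fin m → ℝ, g (Fin.snoc t y) := by
  have e := volume_preserving_piFinSuccAbove (fun _ : Fin (m + 1) => ℝ) (Fin.last m)
  rw [← e.symm.lintegral_comp hg, Measure.volume_eq_prod, lintegral_prod]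
  · simp [MeasurableEquiv.piFinSuccAbove, Fin.insertNthEquiv, Fin.insertNth_last']
  · exact (hg.comp (MeasurableEquiv.measurable _)).aemeasurable

theorem iterInt_succ (p : ℕ → Prop) [DecidablePred p] (m : ℕ) (x : ℝ) :
    iterInt p (m + 1) x =
      ∫⁻ y in Set.Ioo 0 x, ENNReal.ofReal (letterForm (p m) y) * iterInt p m y := by
  have hm : ∀ (m : ℕ), Measurable fun t : Fin m → ℝ =>
      ∏ j : Fin m, ENNReal.ofReal (letterForm (p j) (t j)) := fun m =>
    Finset.measurable_prod _ fun j _ =>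
      ((measurable_letterForm _).comp (measurable_pi_apply j)).ennreal_ofReal
  rw [iterInt, lintegral_fin_succ _ ((hm _).indicator (measurableSet_strictMono_cons_lt _ x)),
    ← lintegral_indicator measurableSet_Ioo]
  refine lintegral_congr fun y => ?_
  by_cases hy : y ∈ Set.Ioo 0 x
  · rw [Set.indicator_of_mem hy, iterInt, ← lintegral_const_mul _
      ((hm _).indicator (measurableSet_strictMono_cons_lt _ y))]
    refine lintegral_congr fun t => ?_
    simp only [Set.indicator_apply, Set.mem_ofPred_eq, strictMono_cons_snoc_iff]
    rw [← Fin.succ_last, Fin.cons_succ, Fin.snoc_last, Fin.prod_univ_castSucc]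
    simp [hy.2, mul_comm]
  · rw [Set.indicator_of_notMem hy]
    refine (lintegral_congr fun t => ?_).trans lintegral_zero
    refine Set.indicator_of_notMem ?_ _
    rintro ⟨h1, h2⟩
    rw [← Fin.succ_last, Fin.cons_succ, Fin.snoc_last] at h2
    refine hy ⟨?_, h2⟩
    have := h1 (Fin.last_pos : 0 < Fin.last (m + 1))
    rwa [← Fin.succ_last, Fin.cons_succ, Fin.snoc_last, Fin.cons_zero] at this

theorem lintegral_ofReal_pow (n : ℕ) {x : ℝ} (hx : 0 ≤ x) :
    ∫⁻ y in Set.Ioo 0 x, ENNReal.ofReal y ^ n = ENNReal.ofReal x ^ (n + 1) / (n + 1 : ℕ) := by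
  have h1 : ∫⁻ y in Set.Ioo 0 x, ENNReal.ofReal y ^ n
      = ∫⁻ y in Set.Ioo 0 x, ENNReal.ofReal (y ^ n) :=
    setLIntegral_congr_fun measurableSet_Ioo fun y hy => (ENNReal.ofReal_pow hy.1.le n).symm
  rw [h1, ← ofReal_integral_eq_lintegral_ofReal, ← integral_Ioc_eq_integral_Ioo,
    ← intervalIntegral.integral_of_le hx, integral_pow, ENNReal.ofReal_div_of_pos (by positivity),
    ← ENNReal.ofReal_pow hx]
  · congr 1
    · simp
    · exact_mod_cast ENNReal.ofReal_natCast (n + 1)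
  · exact ((continuous_pow n).integrableOn_Icc (a := 0) (b := x)).mono_set Set.Ioo_subset_Icc_self
  · exact (ae_restrict_mem measurableSet_Ioo).mono fun y hy => pow_nonneg hy.1.le n

theorem ENNReal.tsum_ite_lt (h : ℕ → ℝ≥0∞) (j : ℕ) :
    ∑' n, (if j < n then h n else 0) = ∑' i, h (i + (j + 1)) := by
  rw [← Summable.sum_add_tsum_nat_add' (k := j + 1) ENNReal.summable,
    Finset.sum_eq_zero fun i hi => if_neg (by simp at hi; omega), zero_add]
  exact tsum_congr fun i => if_pos (by omega)

theorem ENNReal.tsum_sum_range_mul (a h : ℕ → ℝ≥0∞) :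
    ∑' n, (∑ j ∈ Finset.range n, a j) * h n = ∑' j, a j * ∑' i, h (i + (j + 1)) := by
  simp_rw [← ENNReal.tsum_ite_lt, ← ENNReal.tsum_mul_left]
  rw [ENNReal.tsum_comm]
  refine tsum_congr fun n => ?_
  rw [Finset.sum_mul, tsum_eq_sum (s := Finset.range n)]
  · exact Finset.sum_congr rfl fun j hj => by rw [if_pos (Finset.mem_range.1 hj)]
  · intro j hj
    rw [if_neg (by simpa using hj), mul_zero]

theorem iterCoeff_succ_zero (p : ℕ → Prop) [DecidablePred p] (h0 : p 0) (m : ℕ) :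
    iterCoeff p (m + 1) 0 = 0 := by
  induction m with
  | zero => simp [iterCoeff, h0]
  | succ m ih => rw [iterCoeff]; split_ifs <;> simp [ih]

theorem iterInt_eq_tsum (p : ℕ → Prop) [DecidablePred p] (h0 : p 0) (m : ℕ) {x : ℝ}
    (hx : 0 < x) (hx1 : x ≤ 1) :
    iterInt p m x = ∑' n, iterCoeff p m n * ENNReal.ofReal x ^ n := by
  induction m generalizing x with
  | zero =>
    rw [iterInt, lintegral_unique, tsum_eq_single 0 fun n hn => by simp [iterCoeff, hn]]
    have (t : Fin 0 → ℝ) : StrictMono (Fin.cons 0 t : Fin (0 + 1) → ℝ) :=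
      Fin.strictMono_iff_lt_succ.2 fun i => i.elim0
    rw [Set.indicator_of_mem (by exact ⟨this _, hx⟩), volume_pi, Measure.pi_empty_univ]
    simp [iterCoeff]
  | succ m ih =>
    rw [iterInt_succ]
    have hmeas : ∀ n : ℕ, Measurable fun y : ℝ => ENNReal.ofReal y ^ n := fun n =>
      ENNReal.measurable_ofReal.pow_const n
    by_cases hp : p m
    · have h1 : ∀ y ∈ Set.Ioo 0 x, ENNReal.ofReal (letterForm (p m) y) * iterInt p m y =
          ∑' j, ∑' i, iterCoeff p m j * ENNReal.ofReal y ^ (i + j) := by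
        intro y hy
        have hy1 : y < 1 := hy.2.trans_le hx1
        rw [ih hy.1 hy1.le, letterForm, if_pos hp, one_div,
          ENNReal.ofReal_inv_of_pos (by linarith), ENNReal.ofReal_sub _ hy.1.le, ENNReal.ofReal_one,
          ← ENNReal.tsum_geometric, ← ENNReal.tsum_mul_left]
        refine tsum_congr fun j => ?_
        rw [← ENNReal.tsum_mul_right]
        exact tsum_congr fun i => by ring
      rw [setLIntegral_congr_fun measurableSet_Ioo h1, lintegral_tsum]
      · simp only [iterCoeff, if_pos hp]
        simp_rw [div_eq_mul_inv, mul_assoc]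
        rw [ENNReal.tsum_sum_range_mul]
        refine tsum_congr fun j => ?_
        rw [lintegral_tsum fun i => ((hmeas _).const_mul _).aemeasurable, ← ENNReal.tsum_mul_left]
        refine tsum_congr fun i => ?_
        rw [lintegral_const_mul _ (hmeas _), lintegral_ofReal_pow _ hx.le, div_eq_mul_inv,
          mul_comm (ENNReal.ofReal x ^ _), add_assoc]
      · exact fun j => (Measurable.tsum fun i => (hmeas _).const_mul _).aemeasurable
    · obtain _ | m := m
      · exact absurd h0 hp
      have h1 : ∀ y ∈ Set.Ioo 0 x, ENNReal.ofReal (letterForm (p (m + 1)) y) * iterInt p (m + 1) y =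
          ∑' n, iterCoeff p (m + 1) (n + 1) * ENNReal.ofReal y ^ n := by
        intro y hy
        rw [ih hy.1 (hy.2.le.trans hx1), letterForm, if_neg hp, one_div,
          ENNReal.ofReal_inv_of_pos hy.1, tsum_eq_zero_add' ENNReal.summable,
          iterCoeff_succ_zero p h0, zero_mul, zero_add, ← ENNReal.tsum_mul_left]
        refine tsum_congr fun n => ?_
        have hy0 : ENNReal.ofReal y ≠ 0 := by simpa using hy.1
        rw [mul_left_comm, pow_succ', ← mul_assoc (ENNReal.ofReal y)⁻¹,
          ENNReal.inv_mul_cancel hy0 ENNReal.ofReal_ne_top, one_mul]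
      rw [setLIntegral_congr_fun measurableSet_Ioo h1,
        lintegral_tsum fun i => ((hmeas _).const_mul _).aemeasurable,
        tsum_eq_zero_add' (f := fun n => iterCoeff p (m + 1 + 1) n * _) ENNReal.summable,
        iterCoeff_succ_zero p h0, zero_mul, zero_add]
      refine tsum_congr fun n => ?_
      rw [lintegral_const_mul _ (hmeas _), lintegral_ofReal_pow _ hx.le,
        iterCoeff.eq_2 p (n + 1) (m + 1), if_neg hp, div_eq_mul_inv, div_eq_mul_inv, mul_comm (ENNReal.ofReal x ^ _), mul_assoc]

/-- The weight `(n + 1) ^ (-s)` as an extended nonnegative real. -/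
noncomputable def rpowWeight (s : ℝ) (n : ℕ) : ℝ≥0∞ :=
  ENNReal.ofReal ((n + 1 : ℝ) ^ (-s))

theorem rpowWeight_add (s t : ℝ) (n : ℕ) :
    rpowWeight (s + t) n = rpowWeight s n * rpowWeight t n := by
  rw [rpowWeight, rpowWeight, rpowWeight, ← ENNReal.ofReal_mul (by positivity),
    ← Real.rpow_add (by positivity), neg_add]

theorem rpowWeight_antitone {s : ℝ} (hs : 0 ≤ s) : Antitone (rpowWeight s) := fun m n h =>
  ENNReal.ofReal_le_ofReal
    (Real.rpow_le_rpow_of_nonpos (by positivity) (by gcongr) (by linarith))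

theorem tsum_rpowWeight_ne_top {s : ℝ} (hs : 1 < s) : ∑' n, rpowWeight s n ≠ ⊤ := by
  have h : Summable fun n : ℕ => (n : ℝ) ^ (-s) := Real.summable_nat_rpow.2 (by linarith)
  have h' := (summable_nat_add_iff 1).2 h
  simp only [Nat.cast_add, Nat.cast_one] at h'
  exact h'.tsum_ofReal_ne_top

theorem inv_natCast_le_rpowWeight {n : ℕ} (hn : n ≠ 0) :
    (n : ℝ≥0∞)⁻¹ ≤ 2 * rpowWeight 1 n := by
  have h1 : (1 : ℝ) ≤ n := by exact_mod_cast Nat.one_le_iff_ne_zero.2 hn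
  rw [rpowWeight, Real.rpow_neg_one, ← ENNReal.ofReal_natCast,
    ← ENNReal.ofReal_inv_of_pos (by positivity), ← ENNReal.ofReal_ofNat 2,
    ← ENNReal.ofReal_mul (by norm_num)]
  apply ENNReal.ofReal_le_ofReal
  rw [← div_eq_mul_inv, inv_eq_one_div, div_le_div_iff₀ (by positivity) (by positivity)]
  linarith

theorem tsum_iterCoeff_mul_rpowWeight_ne_top (p : ℕ → Prop) [DecidablePred p] (h0 : p 0) (m : ℕ)
    {s : ℝ} (hs : 0 < s) : ∑' n, iterCoeff p m n * rpowWeight s n ≠ ⊤ := by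
  induction m generalizing s with
  | zero =>
    rw [tsum_eq_single 0 fun n hn => by simp [iterCoeff, hn]]
    simp [iterCoeff, rpowWeight]
  | succ m ih =>
    by_cases hp : p m
    · set A := ∑' n, iterCoeff p m n * rpowWeight (s / 2) n
      have hA : A ≠ ⊤ := ih (half_pos hs)
      refine ne_top_of_le_ne_top (b := ∑' n, A * 2 * rpowWeight (1 + s / 2) n) ?_
        (ENNReal.tsum_le_tsum fun n => ?_)
      · rw [ENNReal.tsum_mul_left]
        exact ENNReal.mul_ne_top (ENNReal.mul_ne_top hA (by simp))
          (tsum_rpowWeight_ne_top (by linarith))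
      · rw [iterCoeff, if_pos hp]
        rcases eq_or_ne n 0 with rfl | hn
        · simp
        have h : (∑ j ∈ Finset.range n, iterCoeff p m j) * rpowWeight (s / 2) n ≤ A := by
          rw [Finset.sum_mul]
          refine le_trans (Finset.sum_le_sum fun j hj => ?_) (ENNReal.sum_le_tsum (Finset.range n))
          gcongr
          exact rpowWeight_antitone (by positivity) (Finset.mem_range.1 hj).le
        calc (∑ j ∈ Finset.range n, iterCoeff p m j) / n * rpowWeight s n
            = ((∑ j ∈ Finset.range n, iterCoeff p m j) * rpowWeight (s / 2) n) *
                ((n : ℝ≥0∞)⁻¹ * rpowWeight (s / 2) n) := by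
              rw [← add_halves s, rpowWeight_add, add_halves, div_eq_mul_inv]; ring
          _ ≤ A * (2 * rpowWeight 1 n * rpowWeight (s / 2) n) := by
              gcongr
              exact inv_natCast_le_rpowWeight hn
          _ = A * 2 * rpowWeight (1 + s / 2) n := by rw [rpowWeight_add]; ring
    · refine ne_top_of_le_ne_top (ih hs) (ENNReal.tsum_le_tsum fun n => ?_)
      rw [iterCoeff, if_neg hp]
      gcongr
      rcases eq_or_ne n 0 with rfl | hn
      · obtain _ | m := m
        · exact absurd h0 hp
        · simp [iterCoeff_succ_zero p h0]
      · rw [div_eq_mul_inv]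
        refine mul_le_of_le_one_right' (ENNReal.inv_le_one.2 ?_)
        exact_mod_cast Nat.one_le_iff_ne_zero.2 hn

theorem tsum_iterCoeff_succ_ne_top (p : ℕ → Prop) [DecidablePred p] (h0 : p 0) {m : ℕ}
    (hp : ¬ p m) : ∑' n, iterCoeff p (m + 1) n ≠ ⊤ := by
  refine ne_top_of_le_ne_top (b := ∑' n, 2 * (iterCoeff p m n * rpowWeight 1 n)) ?_
    (ENNReal.tsum_le_tsum fun n => ?_)
  · rw [ENNReal.tsum_mul_left]
    exact ENNReal.mul_ne_top (by simp) (tsum_iterCoeff_mul_rpowWeight_ne_top p h0 m one_pos)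
  · rcases eq_or_ne n 0 with rfl | hn
    · simp [iterCoeff_succ_zero p h0]
    · rw [iterCoeff, if_neg hp, div_eq_mul_inv, mul_left_comm]
      gcongr
      exact inv_natCast_le_rpowWeight hn

theorem iterCoeff_block (p : ℕ → Prop) [DecidablePred p] {K : ℕ} (hK : p K) (q : ℕ)
    (hq : ∀ j < q, ¬ p (K + 1 + j)) (n : ℕ) :
    iterCoeff p (K + 1 + q) n =
      (∑ j ∈ Finset.range n, iterCoeff p K j) * (n : ℝ≥0∞)⁻¹ ^ (q + 1) := by
  induction q with
  | zero => simp [iterCoeff, hK, div_eq_mul_inv]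
  | succ q ih =>
    rw [← add_assoc, iterCoeff, if_neg (hq q q.lt_succ_self), ih fun j hj => hq j (by omega),
      div_eq_mul_inv, mul_assoc, ← pow_succ]

open scoped Classical in
theorem tsum_iterCoeff_mul (p : ℕ → Prop) [DecidablePred p] (κ : ℕ → ℕ) (d : ℕ)
    (hκ : ∀ i < d, 1 ≤ κ i) (hp : ∀ i < d, p (∑ j ∈ Finset.range i, κ j))
    (hn : ∀ i < d, ∀ j, ∑ j ∈ Finset.range i, κ j < j → j < ∑ j ∈ Finset.range (i + 1), κ j → ¬ p j)
    (φ : ℕ → ℝ≥0∞) :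
    ∑' n, iterCoeff p (∑ j ∈ Finset.range d, κ j) n * φ n =
      ∑' g : Fin d → ℕ, if StrictMono (Fin.cons 0 g : Fin (d + 1) → ℕ) then
        (∏ i, ((g i : ℕ) : ℝ≥0∞)⁻¹ ^ κ i) * φ ((Fin.cons 0 g : Fin (d + 1) → ℕ) (Fin.last d))
        else 0 := by
  induction d generalizing φ with
  | zero =>
    have : StrictMono (Fin.cons 0 default : Fin (0 + 1) → ℕ) :=
      Fin.strictMono_iff_lt_succ.2 fun i => i.elim0
    rw [tsum_eq_single 0 fun n hn => by simp [iterCoeff, hn], tsum_eq_single default fun g hg =>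
      absurd (Subsingleton.elim _ _) hg, if_pos this]
    simp [iterCoeff]
  | succ d ih =>
    have hc : ∀ n, iterCoeff p (∑ j ∈ Finset.range (d + 1), κ j) n =
        (∑ j ∈ Finset.range n, iterCoeff p (∑ j ∈ Finset.range d, κ j) j) *
          (n : ℝ≥0∞)⁻¹ ^ κ d := by
      intro n
      have h1 := hκ d d.lt_succ_self
      have h2 := hn d d.lt_succ_self
      rw [Finset.sum_range_succ] at h2 ⊢
      obtain ⟨q, hq⟩ : ∃ q, κ d = q + 1 := ⟨κ d - 1, by omega⟩
      rw [hq, ← iterCoeff_block p (hp d d.lt_succ_self) q fun j hj => h2 _ (by omega) (by omega),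
        ← add_assoc, add_right_comm]
    simp_rw [hc, mul_assoc]
    rw [ENNReal.tsum_sum_range_mul, ih (fun i hi => hκ i (by omega)) (fun i hi => hp i (by omega))
      fun i hi => hn i (by omega)]
    rw [← (Fin.snocEquiv fun _ : Fin (d + 1) => ℕ).tsum_eq,
      ← (Equiv.prodComm _ _).tsum_eq, ENNReal.tsum_prod']
    refine tsum_congr fun g => ?_
    simp only [Fin.snocEquiv, Equiv.prodComm_apply, Prod.swap_prod_mk, Equiv.coe_fn_mk,
      strictMono_cons_snoc_iff]
    split_ifs with hg
    · rw [← ENNReal.tsum_ite_lt (fun n => (n : ℝ≥0∞)⁻¹ ^ κ d * φ n), ← ENNReal.tsum_mul_left]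
      refine tsum_congr fun n => ?_
      rw [← Fin.succ_last, Fin.cons_succ, Fin.snoc_last, Fin.prod_univ_castSucc]
      simp only [Fin.snoc_castSucc, Fin.snoc_last, Fin.val_castSucc, Fin.val_last, hg, true_and,
        mul_ite, mul_zero, mul_assoc]
    · simp [hg]

theorem strictMono_cons_iff {α : Type*} [Preorder α] {m : ℕ} (a : α) (t : Fin m → α) :
    StrictMono (Fin.cons a t : Fin (m + 1) → α) ↔ StrictMono t ∧ ∀ i, a < t i := by
  constructor
  · refine fun h => ⟨fun i j hij => ?_, fun i => ?_⟩
    · simpa using h (Fin.succ_lt_succ_iff.2 hij)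
    · simpa using h (Fin.succ_pos i)
  · rintro ⟨h, h'⟩ i j hij
    cases j using Fin.cases with
    | zero => exact absurd hij (Fin.not_lt_zero i)
    | succ j =>
      cases i using Fin.cases with
      | zero => simpa using h' j
      | succ i => simpa using h (Fin.succ_lt_succ_iff.1 hij)

theorem openSimplex_eq (ℓ : ℕ) : openSimplex ℓ =
    {t : Fin ℓ → ℝ | StrictMono (Fin.cons 0 t : Fin (ℓ + 1) → ℝ) ∧
      (Fin.cons 0 t : Fin (ℓ + 1) → ℝ) (Fin.last ℓ) < 1} := by
  ext t
  simp only [openSimplex, Set.mem_ofPred_eq, Set.mem_Ioo]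
  constructor
  · rintro ⟨h, h'⟩
    refine ⟨(strictMono_cons_iff _ _).2 ⟨h, fun i => (h' i).1⟩, ?_⟩
    cases ℓ with
    | zero => simp
    | succ ℓ =>
      rw [← Fin.succ_last, Fin.cons_succ]
      exact (h' _).2
  · rintro ⟨h, h'⟩
    have h1 := (strictMono_cons_iff _ _).1 h
    refine ⟨h1.1, fun j => ⟨h1.2 j, lt_of_le_of_lt ?_ h'⟩⟩
    simpa using h.monotone (Fin.le_last j.succ)

theorem measurableSet_openSimplex (ℓ : ℕ) : MeasurableSet (openSimplex ℓ) := by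
  rw [openSimplex_eq]
  exact measurableSet_strictMono_cons_lt ℓ 1

theorem kontsevichIntegrand_eq (r : ℕ) (k : Fin (r + 1) → ℕ) (t : Fin (∑ i, k i) → ℝ) :
    kontsevichIntegrand r k t = ∏ j : Fin (∑ i, k i), letterForm (posIsOne r k j) (t j) :=
  rfl

theorem measurable_kontsevichIntegrand (r : ℕ) (k : Fin (r + 1) → ℕ) :
    Measurable (kontsevichIntegrand r k) :=
  Finset.measurable_prod _ fun j _ => (measurable_letterForm _).comp (measurable_pi_apply j)

theorem letterForm_nonneg (q : Prop) [Decidable q] {y : ℝ} (hy : y ∈ Set.Ioo (0 : ℝ) 1) :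
    0 ≤ letterForm q y := by
  unfold letterForm
  split_ifs
  · exact one_div_nonneg.2 (by linarith [hy.2])
  · exact one_div_nonneg.2 hy.1.le

theorem setLIntegral_kontsevichIntegrand (r : ℕ) (k : Fin (r + 1) → ℕ) :
    ∫⁻ t in openSimplex (∑ i, k i), ENNReal.ofReal (kontsevichIntegrand r k t) =
      iterInt (posIsOne r k) (∑ i, k i) 1 := by
  rw [iterInt, lintegral_indicator (measurableSet_strictMono_cons_lt _ _), ← openSimplex_eq]
  refine setLIntegral_congr_fun (measurableSet_openSimplex _) fun t ht => ?_
  rw [kontsevichIntegrand_eq, ENNReal.ofReal_prod_of_nonneg]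
  exact fun j _ => letterForm_nonneg _ (ht.2 j)

/-- Extension by zero of a composition to all of `ℕ`. -/
def extendNat (r : ℕ) (k : Fin (r + 1) → ℕ) (i : ℕ) : ℕ :=
  if h : i < r + 1 then k ⟨i, h⟩ else 0

theorem extendNat_val (r : ℕ) (k : Fin (r + 1) → ℕ) (i : Fin (r + 1)) :
    extendNat r k i = k i :=
  dif_pos i.2

theorem sum_eq_sum_range_extendNat (r : ℕ) (k : Fin (r + 1) → ℕ) :
    ∑ i, k i = ∑ j ∈ Finset.range (r + 1), extendNat r k j := by
  simp only [Finset.sum_range, extendNat_val]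

theorem posIsOne_iff (r : ℕ) (k : Fin (r + 1) → ℕ) (j : ℕ) :
    posIsOne r k j ↔ ∃ i < r + 1, ∑ i' ∈ Finset.range i, extendNat r k i' = j := by
  have h : ∀ i : Fin (r + 1), ∑ i' ∈ Finset.univ.filter (· < i), k i' =
      ∑ i' ∈ Finset.range i, extendNat r k i' := by
    intro i
    have hi : Finset.range i = (Finset.range (r + 1)).filter (· < (i : ℕ)) := by
      ext; simp; omega
    rw [hi, Finset.sum_filter, Finset.sum_filter, Finset.sum_range]
    simp only [extendNat_val, Fin.lt_def]
  simp only [posIsOne, Finset.mem_image, Finset.mem_univ, true_and, h]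
  exact ⟨fun ⟨i, hi⟩ => ⟨i, i.2, hi⟩, fun ⟨i, hi, hj⟩ => ⟨⟨i, hi⟩, hj⟩⟩

theorem not_posIsOne (r : ℕ) (k : Fin (r + 1) → ℕ) {i j : ℕ}
    (h1 : ∑ i' ∈ Finset.range i, extendNat r k i' < j)
    (h2 : j < ∑ i' ∈ Finset.range (i + 1), extendNat r k i') : ¬ posIsOne r k j := by
  rw [posIsOne_iff]
  rintro ⟨l, -, rfl⟩
  have hmono : Monotone fun n => ∑ i' ∈ Finset.range n, extendNat r k i' := fun a b hab =>
    Finset.sum_le_sum_of_subset (Finset.range_subset_range.2 hab)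
  have := hmono.reflect_lt h1
  have := hmono.reflect_lt h2
  omega

theorem mzv_eq_toReal (r : ℕ) (k : Fin (r + 1) → ℕ) (hk : ∀ i, 1 ≤ k i) :
    mzv r k = (∑' n, iterCoeff (posIsOne r k) (∑ i, k i) n).toReal := by
  classical
  have h := tsum_iterCoeff_mul (posIsOne r k) (extendNat r k) (r + 1)
    (fun i hi => (hk ⟨i, hi⟩).trans_eq (extendNat_val r k ⟨i, hi⟩).symm)
    (fun i hi => (posIsOne_iff r k _).2 ⟨i, hi, rfl⟩)
    (fun i _ j h1 h2 => not_posIsOne r k h1 h2) 1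
  simp only [← sum_eq_sum_range_extendNat, Pi.one_apply, mul_one, strictMono_cons_iff,
    extendNat_val] at h
  have h2 := tsum_subtype {g : Fin (r + 1) → ℕ | StrictMono g ∧ ∀ i, 0 < g i}
    fun g => ∏ i, ((g i : ℕ) : ℝ≥0∞)⁻¹ ^ k i
  simp only [Set.indicator_apply, Set.mem_ofPred_eq] at h2
  rw [h, ← h2, ENNReal.tsum_toReal_eq]
  · refine tsum_congr fun g => ?_
    simp [ENNReal.toReal_prod]
  · rintro ⟨g, -, hg⟩
    refine ENNReal.prod_ne_top fun i _ => ENNReal.pow_ne_top ?_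
    simpa using (hg i).ne'

/-- the function `∏_{j=1}^{ℓ} f_{ε_j}(t_j)` is integrable on the open
simplex `0 < t₁ < ⋯ < t_ℓ < 1` and its integral equals the multiple zeta value
`ζ(k₀, …, k_r)`. -/
theorem stmt13 (r : ℕ) (k : Fin (r + 1) → ℕ) (hk : ∀ i, 1 ≤ k i)
    (hlast : 2 ≤ k (Fin.last r)) :
    IntegrableOn (kontsevichIntegrand r k) (openSimplex (∑ i, k i)) volume ∧
    ∫ t in openSimplex (∑ i, k i), kontsevichIntegrand r k t = mzv r k := by

  have h0 : posIsOne r k 0 := (posIsOne_iff r k 0).2 ⟨0, by omega, by simp⟩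
  have hlint : ∫⁻ t in openSimplex (∑ i, k i), ENNReal.ofReal (kontsevichIntegrand r k t) =
      ∑' n, iterCoeff (posIsOne r k) (∑ i, k i) n := by
    rw [setLIntegral_kontsevichIntegrand, iterInt_eq_tsum _ h0 _ one_pos le_rfl]
    simp
  have hfin : ∑' n, iterCoeff (posIsOne r k) (∑ i, k i) n ≠ ⊤ := by
    have hs := sum_eq_sum_range_extendNat r k
    have hsucc := Finset.sum_range_succ (extendNat r k) r
    have hr := extendNat_val r k (Fin.last r)
    rw [Fin.val_last] at hr
    obtain ⟨m, hm⟩ : ∃ m, ∑ i, k i = m + 1 := ⟨∑ i, k i - 1, by omega⟩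
    rw [hm]
    exact tsum_iterCoeff_succ_ne_top _ h0 (not_posIsOne r k (i := r) (by omega) (by omega))
  have hnonneg : 0 ≤ᵐ[volume.restrict (openSimplex (∑ i, k i))] kontsevichIntegrand r k :=
    (ae_restrict_mem (measurableSet_openSimplex _)).mono fun t ht =>
      Finset.prod_nonneg fun j _ => letterForm_nonneg _ (ht.2 j)
  have hmeas := (measurable_kontsevichIntegrand r k).aestronglyMeasurable
    (μ := volume.restrict (openSimplex (∑ i, k i)))
  refine ⟨⟨hmeas, ?_⟩, ?_⟩
  · rw [hasFiniteIntegral_iff_ofReal hnonneg, hlint]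
    exact hfin.lt_top
  · rw [integral_eq_lintegral_of_nonneg_ae hnonneg hmeas, hlint, mzv_eq_toReal r k hk]
end

section
/- The ℚ-linear span in ℝ of 1 together with all multiple zeta values ζ(k_1,…,k_r) (over all r ≥ 1 and all k_1,…,k_r ≥ 1 with k_r ≥ 2) is closed under multiplication; in particular, the product of any two multiple zeta values is a ℚ-linear combination of multiple zeta values, so this span is a ℚ-subalgebra 𝛇 of ℝ. -/
/-- The set of all multiple zeta values `ζ(k₀,…,k_r)` with all `kᵢ ≥ 1` and `k_r ≥ 2`. -/
def mzvSet : Set ℝ :=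
  {x | ∃ (r : ℕ) (k : Fin (r + 1) → ℕ),
    (∀ i, 1 ≤ k i) ∧ 2 ≤ k (Fin.last r) ∧ x = mzv r k}

open Finset Filter Topology

/-- The index set of `truncatedMzv`: strictly increasing tuples of positive integers `≤ N`. -/
def boundedTuples (r N : ℕ) : Finset (Fin r → ℕ) :=
  open scoped Classical in
  {g ∈ Fintype.piFinset fun _ => range (N + 1) | StrictMono g ∧ ∀ i, 0 < g i}

lemma mem_boundedTuples {r N : ℕ} {g : Fin r → ℕ} :
    g ∈ boundedTuples r N ↔ (∀ i, g i ≤ N) ∧ StrictMono g ∧ ∀ i, 0 < g i := by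
  simp [boundedTuples]

/-- The multiple harmonic sum obtained by truncating a multiple zeta value at `N`. -/
noncomputable def truncatedMzv {r : ℕ} (k : Fin r → ℕ) (N : ℕ) : ℝ :=
  ∑ g ∈ boundedTuples r N, ∏ i, (1 : ℝ) / ((g i : ℝ) ^ (k i))

/-- The operator `f ↦ (N ↦ ∑_{1 ≤ n ≤ N} f (n - 1) / n ^ a)` on sequences. -/
noncomputable def harmonicOp (a : ℕ) : (ℕ → ℝ) →ₗ[ℚ] (ℕ → ℝ) where
  toFun f N := ∑ n ∈ range N, 1 / ((n : ℝ) + 1) ^ a * f n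
  map_add' f g := by
    funext N
    simp [mul_add, sum_add_distrib]
  map_smul' c f := by
    funext N
    simp [Finset.smul_sum]

lemma harmonicOp_apply (a : ℕ) (f : ℕ → ℝ) (N : ℕ) :
    harmonicOp a f N = ∑ n ∈ range N, 1 / ((n : ℝ) + 1) ^ a * f n := rfl

lemma harmonicOp_mul_harmonicOp (a b : ℕ) (f g : ℕ → ℝ) :
    harmonicOp a f * harmonicOp b g =
      harmonicOp a (f * harmonicOp b g) + harmonicOp b (harmonicOp a f * g)
        + harmonicOp (a + b) (f * g) := by
  funext N
  induction N with
  | zero => simp [harmonicOp_apply]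
  | succ N ih =>
    simp only [Pi.mul_apply, Pi.add_apply] at ih ⊢
    have key (c : ℕ) (h : ℕ → ℝ) : harmonicOp c h (N + 1) =
        harmonicOp c h N + 1 / ((N : ℝ) + 1) ^ c * h N := by
      simp [harmonicOp_apply, sum_range_succ]
    simp only [key, add_mul, mul_add, ih, Pi.mul_apply, pow_add, one_div, mul_inv]
    ring

lemma truncatedMzv_fin_zero (k : Fin 0 → ℕ) : truncatedMzv k = 1 := by
  funext N
  have : boundedTuples 0 N = {Fin.elim0} := by
    ext g
    simp [mem_boundedTuples, Subsingleton.elim g Fin.elim0, Subsingleton.strictMono]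
  simp [truncatedMzv, this]

lemma boundedTuples_succ_eq_union (r N : ℕ) :
    boundedTuples (r + 1) (N + 1) = boundedTuples (r + 1) N ∪
      (boundedTuples r N).image fun g => (Fin.snoc g (N + 1) : Fin (r + 1) → ℕ) := by
  classical
  ext g
  simp only [mem_union, mem_image, mem_boundedTuples]
  constructor
  · rintro ⟨hle, hmono, hpos⟩
    by_cases h : g (Fin.last r) ≤ N
    · exact .inl ⟨fun i => (hmono.monotone (Fin.le_last i)).trans h, hmono, hpos⟩
    · have hlast : g (Fin.last r) = N + 1 := by have := hle (Fin.last r); omega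
      refine .inr ⟨Fin.init g, ⟨fun i => ?_, fun i j hij => hmono (by simpa using hij),
        fun i => hpos _⟩, ?_⟩
      · have := hmono (Fin.castSucc_lt_last i)
        simp only [Fin.init]
        omega
      · rw [← hlast, Fin.snoc_init_self]
  · rintro (⟨hle, h⟩ | ⟨g, ⟨hle, hmono, hpos⟩, rfl⟩)
    · exact ⟨fun i => (hle i).trans N.le_succ, h⟩
    · refine ⟨fun i => ?_, fun i j hij => ?_, fun i => ?_⟩
      · induction i using Fin.lastCases with
        | last => simp
        | cast i => simpa using (hle i).trans N.le_succ
      · induction j using Fin.lastCases with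
        | last =>
          induction i using Fin.lastCases with
          | last => simp at hij
          | cast i => simpa using Nat.lt_succ_of_le (hle i)
        | cast j =>
          induction i using Fin.lastCases with
          | last => exact absurd hij (Fin.le_last _).not_gt
          | cast i => simpa using hmono (by simpa using hij)
      · induction i using Fin.lastCases with
        | last => simp
        | cast i => simpa using hpos i

lemma truncatedMzv_succ {r : ℕ} (k : Fin (r + 1) → ℕ) (N : ℕ) :
    truncatedMzv k (N + 1) = truncatedMzv k N +
      1 / ((N : ℝ) + 1) ^ k (Fin.last r) * truncatedMzv (Fin.init k) N := by
  have hdisj : Disjoint (boundedTuples (r + 1) N)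
      ((boundedTuples r N).image fun g => (Fin.snoc g (N + 1) : Fin (r + 1) → ℕ)) := by
    rw [disjoint_left]
    intro g hg hg'
    obtain ⟨g, -, rfl⟩ := mem_image.1 hg'
    have := (mem_boundedTuples.1 hg).1 (Fin.last r)
    simp at this
  rw [truncatedMzv, boundedTuples_succ_eq_union, sum_union hdisj, sum_image, ← truncatedMzv]
  · simp [truncatedMzv, Fin.prod_univ_castSucc, mul_sum, Fin.init, mul_comm]
  · intro g _ g' _ h
    simpa using congrArg (Fin.init (α := fun _ => ℕ)) h

lemma truncatedMzv_eq_harmonicOp {r : ℕ} (k : Fin (r + 1) → ℕ) :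
    truncatedMzv k = harmonicOp (k (Fin.last r)) (truncatedMzv (Fin.init k)) := by
  funext N
  induction N with
  | zero =>
    have : boundedTuples (r + 1) 0 = ∅ := by
      refine eq_empty_of_forall_notMem fun g hg => ?_
      obtain ⟨h, -, h'⟩ := mem_boundedTuples.1 hg
      exact (h 0).not_gt (h' 0)
    simp [truncatedMzv, harmonicOp_apply, this]
  | succ N ih => rw [truncatedMzv_succ, ih, harmonicOp_apply, harmonicOp_apply, sum_range_succ]

lemma truncatedMzv_snoc {r : ℕ} (k : Fin r → ℕ) (a : ℕ) :
    truncatedMzv (Fin.snoc k a : Fin (r + 1) → ℕ) = harmonicOp a (truncatedMzv k) := by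
  simp [truncatedMzv_eq_harmonicOp]

/-- The span of the multiple harmonic sums with positive exponents. -/
noncomputable def harmonicSpan : Submodule ℚ (ℕ → ℝ) :=
  Submodule.span ℚ {f | ∃ (r : ℕ) (k : Fin r → ℕ), (∀ i, 1 ≤ k i) ∧ f = truncatedMzv k}

/-- The span of `1` and the multiple harmonic sums whose truncation parameter can be sent to
infinity. -/
noncomputable def convergentHarmonicSpan : Submodule ℚ (ℕ → ℝ) :=
  Submodule.span ℚ (insert 1 {f | ∃ (r : ℕ) (k : Fin (r + 1) → ℕ),
    (∀ i, 1 ≤ k i) ∧ 2 ≤ k (Fin.last r) ∧ f = truncatedMzv k})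

lemma one_le_snoc {r a : ℕ} {k : Fin r → ℕ} (hk : ∀ i, 1 ≤ k i) (ha : 1 ≤ a) (i : Fin (r + 1)) :
    1 ≤ (Fin.snoc k a : Fin (r + 1) → ℕ) i := by
  induction i using Fin.lastCases with
  | last => simpa
  | cast i => simpa using hk i

lemma harmonicOp_mem_harmonicSpan {a : ℕ} (ha : 1 ≤ a) {f : ℕ → ℝ} (hf : f ∈ harmonicSpan) :
    harmonicOp a f ∈ harmonicSpan := by
  refine (Submodule.span_le (p := harmonicSpan.comap (harmonicOp a))).2 ?_ hf
  rintro _ ⟨r, k, hk, rfl⟩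
  exact Submodule.subset_span ⟨r + 1, _, one_le_snoc hk ha, (truncatedMzv_snoc k a).symm⟩

lemma harmonicOp_mem_convergentHarmonicSpan {a : ℕ} (ha : 2 ≤ a) {f : ℕ → ℝ}
    (hf : f ∈ harmonicSpan) : harmonicOp a f ∈ convergentHarmonicSpan := by
  refine (Submodule.span_le (p := convergentHarmonicSpan.comap (harmonicOp a))).2 ?_ hf
  rintro _ ⟨r, k, hk, rfl⟩
  exact Submodule.subset_span (.inr ⟨r, _, one_le_snoc hk (one_le_two.trans ha), by simpa,
    (truncatedMzv_snoc k a).symm⟩)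

lemma truncatedMzv_mem_harmonicSpan {r : ℕ} {k : Fin r → ℕ} (hk : ∀ i, 1 ≤ k i) :
    truncatedMzv k ∈ harmonicSpan :=
  Submodule.subset_span ⟨r, k, hk, rfl⟩

lemma truncatedMzv_mul_mem_harmonicSpan {r s : ℕ} {k : Fin r → ℕ} {l : Fin s → ℕ}
    (hk : ∀ i, 1 ≤ k i) (hl : ∀ i, 1 ≤ l i) :
    truncatedMzv k * truncatedMzv l ∈ harmonicSpan := by
  induction r generalizing s with
  | zero =>
    rw [truncatedMzv_fin_zero, one_mul]
    exact truncatedMzv_mem_harmonicSpan hl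
  | succ r ihr =>
    induction s with
    | zero =>
      rw [truncatedMzv_fin_zero, mul_one]
      exact truncatedMzv_mem_harmonicSpan hk
    | succ s ihs =>
      have h₁ := ihr (k := Fin.init k) (fun i => hk _) hl
      have h₂ := ihs (l := Fin.init l) (fun i => hl _)
      have h₃ := ihr (k := Fin.init k) (l := Fin.init l) (fun i => hk _) (fun i => hl _)
      rw [truncatedMzv_eq_harmonicOp l] at h₁
      rw [truncatedMzv_eq_harmonicOp k] at h₂
      rw [truncatedMzv_eq_harmonicOp k, truncatedMzv_eq_harmonicOp l, harmonicOp_mul_harmonicOp]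
      exact add_mem (add_mem (harmonicOp_mem_harmonicSpan (hk _) h₁)
        (harmonicOp_mem_harmonicSpan (hl _) h₂))
        (harmonicOp_mem_harmonicSpan (le_add_right (hk _)) h₃)

lemma mul_mem_convergentHarmonicSpan {f g : ℕ → ℝ} (hf : f ∈ convergentHarmonicSpan)
    (hg : g ∈ convergentHarmonicSpan) : f * g ∈ convergentHarmonicSpan := by
  suffices h : convergentHarmonicSpan * convergentHarmonicSpan ≤ convergentHarmonicSpan from
    h (Submodule.mul_mem_mul hf hg)
  conv_lhs => rw [convergentHarmonicSpan, Submodule.span_mul_span]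
  rw [Submodule.span_le]
  rintro _ ⟨f, hf, g, hg, rfl⟩
  obtain rfl | ⟨r, k, hk, hk', rfl⟩ := hf
  · simp only [one_mul]
    exact Submodule.subset_span hg
  obtain rfl | ⟨s, l, hl, hl', rfl⟩ := hg
  · simp only [mul_one]
    exact Submodule.subset_span (.inr ⟨r, k, hk, hk', rfl⟩)
  have h₁ := truncatedMzv_mul_mem_harmonicSpan (k := Fin.init k) (fun i => hk _) hl
  have h₂ := truncatedMzv_mul_mem_harmonicSpan (l := Fin.init l) hk (fun i => hl _)
  have h₃ := truncatedMzv_mul_mem_harmonicSpan (k := Fin.init k) (l := Fin.init l)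
    (fun i => hk _) (fun i => hl _)
  rw [truncatedMzv_eq_harmonicOp l] at h₁
  rw [truncatedMzv_eq_harmonicOp k] at h₂
  simp only [SetLike.mem_coe]
  rw [truncatedMzv_eq_harmonicOp k, truncatedMzv_eq_harmonicOp l, harmonicOp_mul_harmonicOp]
  exact add_mem (add_mem (harmonicOp_mem_convergentHarmonicSpan hk' h₁)
    (harmonicOp_mem_convergentHarmonicSpan hl' h₂))
    (harmonicOp_mem_convergentHarmonicSpan (le_add_right hk') h₃)

lemma truncatedMzv_nonneg {r : ℕ} (k : Fin r → ℕ) (N : ℕ) : 0 ≤ truncatedMzv k N :=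
  sum_nonneg fun _ _ => prod_nonneg fun _ _ => by positivity

lemma truncatedMzv_mono {r : ℕ} (k : Fin r → ℕ) : Monotone (truncatedMzv k) := fun M N h =>
  sum_le_sum_of_subset_of_nonneg
    (fun g hg => by
      rw [mem_boundedTuples] at hg ⊢
      exact ⟨fun i => (hg.1 i).trans h, hg.2⟩)
    fun _ _ _ => prod_nonneg fun _ _ => by positivity

lemma truncatedMzv_le_harmonic_pow {r : ℕ} {k : Fin r → ℕ} (hk : ∀ i, 1 ≤ k i) (N : ℕ) :
    truncatedMzv k N ≤ (harmonic N : ℝ) ^ r := by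
  induction r with
  | zero => simp [truncatedMzv_fin_zero]
  | succ r ih =>
    rw [truncatedMzv_eq_harmonicOp, harmonicOp_apply, pow_succ', harmonic, Rat.cast_sum, sum_mul]
    refine sum_le_sum fun n hn => mul_le_mul ?_ ?_ (truncatedMzv_nonneg _ _) (by positivity)
    · push_cast
      rw [one_div]
      gcongr
      exact le_self_pow₀ (by linarith [n.cast_nonneg (α := ℝ)])
        (Nat.one_le_iff_ne_zero.1 (hk _))
    · rw [← Rat.cast_sum]
      exact (truncatedMzv_mono _ (mem_range.1 hn).le).trans (ih fun i => hk _)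

lemma summable_harmonic_pow_div_sq (r : ℕ) :
    Summable fun n : ℕ => 1 / ((n : ℝ) + 1) ^ 2 * (harmonic n : ℝ) ^ r := by
  set ε : ℝ := 1 / (2 * (r + 1)) with hε
  have hε₀ : 0 < ε := by positivity
  have hbound (n : ℕ) : (harmonic n : ℝ) ≤ (1 + 1 / ε) * ((n : ℝ) + 1) ^ ε := by
    have h₁ : (1 : ℝ) ≤ ((n : ℝ) + 1) ^ ε :=
      Real.one_le_rpow (by linarith [n.cast_nonneg (α := ℝ)]) hε₀.le
    have h₂ : Real.log n ≤ ((n : ℝ) + 1) ^ ε / ε :=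
      (Real.log_le_rpow_div n.cast_nonneg hε₀).trans (by gcongr; linarith)
    calc (harmonic n : ℝ) ≤ 1 + Real.log n := harmonic_le_one_add_log n
      _ ≤ ((n : ℝ) + 1) ^ ε + ((n : ℝ) + 1) ^ ε / ε := add_le_add h₁ h₂
      _ = _ := by ring
  have hsum : Summable fun n : ℕ => (1 + 1 / ε) ^ r * ((n : ℝ) + 1) ^ (-3 / 2 : ℝ) := by
    refine Summable.mul_left _ ?_
    simpa using (summable_nat_add_iff 1).2
      (Real.summable_nat_rpow.2 (by norm_num : (-3 / 2 : ℝ) < -1))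
  refine hsum.of_nonneg_of_le (fun n => ?_) fun n => ?_
  · have : (0 : ℝ) ≤ harmonic n := by simp only [harmonic]; push_cast; positivity
    positivity
  · have h₀ : (0 : ℝ) ≤ harmonic n := by simp only [harmonic]; push_cast; positivity
    have hn : (1 : ℝ) ≤ (n : ℝ) + 1 := by linarith [n.cast_nonneg (α := ℝ)]
    calc 1 / ((n : ℝ) + 1) ^ 2 * (harmonic n : ℝ) ^ r
        ≤ 1 / ((n : ℝ) + 1) ^ 2 * ((1 + 1 / ε) * ((n : ℝ) + 1) ^ ε) ^ r := by
          gcongr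
          exact hbound n
      _ = (1 + 1 / ε) ^ r * (((n : ℝ) + 1) ^ (-2 : ℝ) * ((n : ℝ) + 1) ^ (ε * r)) := by
          rw [mul_pow, Real.rpow_mul (by positivity), Real.rpow_natCast,
            Real.rpow_neg (by positivity), Real.rpow_two]
          ring
      _ ≤ (1 + 1 / ε) ^ r * ((n : ℝ) + 1) ^ (-3 / 2 : ℝ) := by
          rw [← Real.rpow_add (by positivity)]
          gcongr
          have : ε * r ≤ 1 / 2 := by
            rw [hε, div_mul_eq_mul_div, div_le_div_iff₀ (by positivity) (by positivity)]
            linarith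
          linarith

lemma exists_truncatedMzv_le {r : ℕ} {k : Fin (r + 1) → ℕ} (hk : ∀ i, 1 ≤ k i)
    (hk' : 2 ≤ k (Fin.last r)) : ∃ C, ∀ N, truncatedMzv k N ≤ C := by
  refine ⟨∑' n : ℕ, 1 / ((n : ℝ) + 1) ^ 2 * (harmonic n : ℝ) ^ r, fun N => ?_⟩
  rw [truncatedMzv_eq_harmonicOp, harmonicOp_apply]
  refine le_trans (sum_le_sum fun n _ => ?_)
    ((summable_harmonic_pow_div_sq r).sum_le_tsum (range N) fun n _ => ?_)
  · refine mul_le_mul ?_ (truncatedMzv_le_harmonic_pow (fun i => hk _) n)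
      (truncatedMzv_nonneg _ _) (by positivity)
    gcongr
    linarith [n.cast_nonneg (α := ℝ)]
  · have : (0 : ℝ) ≤ harmonic n := by simp only [harmonic]; push_cast; positivity
    positivity

lemma tendsto_truncatedMzv {r : ℕ} {k : Fin (r + 1) → ℕ} (hk : ∀ i, 1 ≤ k i)
    (hk' : 2 ≤ k (Fin.last r)) : Tendsto (truncatedMzv k) atTop (𝓝 (mzv r k)) := by
  classical
  let p : (Fin (r + 1) → ℕ) → Prop := fun g => StrictMono g ∧ ∀ i, 0 < g i
  let F : {g // p g} → ℝ := fun g => ∏ i, (1 : ℝ) / ((g.1 i : ℝ) ^ (k i))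
  let s : ℕ → Finset {g // p g} := fun N => (boundedTuples (r + 1) N).subtype p
  have hF (g) : 0 ≤ F g := prod_nonneg fun _ _ => by positivity
  have hs : Tendsto s atTop atTop := by
    refine tendsto_atTop_finset_of_monotone (fun M N h g hg => ?_) fun g => ⟨g.1 (Fin.last r), ?_⟩
    · simp only [s, mem_subtype, mem_boundedTuples] at hg ⊢
      exact ⟨fun i => (hg.1 i).trans h, hg.2⟩
    · simp only [s, mem_subtype, mem_boundedTuples]
      exact ⟨fun i => g.2.1.monotone (Fin.le_last i), g.2⟩
  have hsum (N) : ∑ g ∈ s N, F g = truncatedMzv k N := by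
    refine (sum_subtype_eq_sum_filter fun g : Fin (r + 1) → ℕ =>
      ∏ i, (1 : ℝ) / ((g i : ℝ) ^ (k i))).trans ?_
    rw [filter_true_of_mem fun g hg => (mem_boundedTuples.1 hg).2, truncatedMzv]
  obtain ⟨C, hC⟩ := exists_truncatedMzv_le hk hk'
  have hsummable : Summable F := by
    refine summable_of_sum_le hF (c := C) fun u => ?_
    obtain ⟨N, hN⟩ := (hs.eventually_ge_atTop u).exists
    exact (sum_le_sum_of_subset_of_nonneg hN fun g _ _ => hF g).trans ((hsum N).trans_le (hC N))
  have := hsummable.hasSum.comp hs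
  exact this.congr hsum

lemma exists_tendsto_of_mem_convergentHarmonicSpan {f : ℕ → ℝ}
    (hf : f ∈ convergentHarmonicSpan) :
    ∃ x ∈ Submodule.span ℚ (insert (1 : ℝ) mzvSet), Tendsto f atTop (𝓝 x) := by
  induction hf using Submodule.span_induction with
  | mem f hf =>
    obtain rfl | ⟨r, k, hk, hk', rfl⟩ := hf
    · exact ⟨1, Submodule.subset_span (.inl rfl), tendsto_const_nhds⟩
    · exact ⟨mzv r k, Submodule.subset_span (.inr ⟨r, k, hk, hk', rfl⟩),
        tendsto_truncatedMzv hk hk'⟩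
  | zero => exact ⟨0, zero_mem _, tendsto_const_nhds⟩
  | add f g _ _ ihf ihg =>
    obtain ⟨x, hx, hfx⟩ := ihf
    obtain ⟨y, hy, hgy⟩ := ihg
    exact ⟨x + y, add_mem hx hy, hfx.add hgy⟩
  | smul c f _ ih =>
    obtain ⟨x, hx, hfx⟩ := ih
    exact ⟨c • x, Submodule.smul_mem _ c hx, hfx.const_smul c⟩

lemma exists_mem_convergentHarmonicSpan_tendsto {x : ℝ}
    (hx : x ∈ Submodule.span ℚ (insert (1 : ℝ) mzvSet)) :
    ∃ f ∈ convergentHarmonicSpan, Tendsto f atTop (𝓝 x) := by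
  induction hx using Submodule.span_induction with
  | mem x hx =>
    obtain rfl | ⟨r, k, hk, hk', rfl⟩ := hx
    · exact ⟨1, Submodule.subset_span (.inl rfl), tendsto_const_nhds⟩
    · exact ⟨truncatedMzv k, Submodule.subset_span (.inr ⟨r, k, hk, hk', rfl⟩),
        tendsto_truncatedMzv hk hk'⟩
  | zero => exact ⟨0, zero_mem _, tendsto_const_nhds⟩
  | add x y _ _ ihx ihy =>
    obtain ⟨f, hf, hfx⟩ := ihx
    obtain ⟨g, hg, hgy⟩ := ihy
    exact ⟨f + g, add_mem hf hg, hfx.add hgy⟩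
  | smul c x _ ih =>
    obtain ⟨f, hf, hfx⟩ := ih
    exact ⟨c • f, Submodule.smul_mem _ c hf, hfx.const_smul c⟩

/-- the ℚ-linear span in ℝ of 1 together with all multiple zeta values is
closed under multiplication (hence is a ℚ-subalgebra of ℝ). -/
theorem stmt15 :
    ∀ x ∈ Submodule.span ℚ (insert (1 : ℝ) mzvSet),
      ∀ y ∈ Submodule.span ℚ (insert (1 : ℝ) mzvSet),
        x * y ∈ Submodule.span ℚ (insert (1 : ℝ) mzvSet) := by
  intro x hx y hy
  obtain ⟨f, hf, hfx⟩ := exists_mem_convergentHarmonicSpan_tendsto hx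
  obtain ⟨g, hg, hgy⟩ := exists_mem_convergentHarmonicSpan_tendsto hy
  obtain ⟨z, hz, hfgz⟩ :=
    exists_tendsto_of_mem_convergentHarmonicSpan (mul_mem_convergentHarmonicSpan hf hg)
  rwa [tendsto_nhds_unique (hfx.mul hgy) hfgz]
end
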